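/- Let Y be an exponential random variable with parameter θ > 0, i.e., P[Y > y] = e^{-θy} for y > 0, and let Z ≥ 0 be a random variable with finite mean, independent of Y. Then E[min{Z, Y}] ≤ 2·E[Z] / (2 + θ·E[Z]). -/

import Mathlib

open MeasureTheory ProbabilityTheory Real

/-- The Padé bound for the exponential, in the form `1 - exp (-x) ≤ 2 x / (2 + x)`. -/
lemma one_sub_exp_neg_le_two_mul_div {x : ℝ} (hx : 0 ≤ x) :
    1 - exp (-x) ≤ 2 * x / (2 + x) := by
  rw [le_div_iff₀ (by positivity)]
  rcases le_or_gt 2 x with h | h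
  · nlinarith [mul_nonneg (exp_pos (-x)).le (by positivity : 0 ≤ 2 + x)]
  · have hpos : 0 < 2 - x := by linarith
    have hlog := le_log_one_add_of_nonneg (x := 2 * x / (2 - x)) (by positivity)
    have hleft : 2 * (2 * x / (2 - x)) / (2 * x / (2 - x) + 2) = x := by
      field_simp
      ring
    have hright : 1 + 2 * x / (2 - x) = (2 + x) / (2 - x) := by
      field_simp
      ring
    rw [hleft, hright, le_log_iff_exp_le (by positivity), le_div_iff₀ hpos] at hlog
    have hmul := mul_le_mul_of_nonneg_left hlog (exp_pos (-x)).le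
    rw [← mul_assoc, ← exp_add, neg_add_cancel, exp_zero] at hmul
    linarith

/-- The mean of an exponential variable truncated at height `z`, from its tail. -/
lemma integral_min_max_zero_of_exp_tail {ν : Measure ℝ} [IsProbabilityMeasure ν] {θ : ℝ}
    (hθ : 0 < θ) (hν : ∀ y : ℝ, 0 < y → ν (Set.Ioi y) = ENNReal.ofReal (exp (-θ * y)))
    {z : ℝ} (hz : 0 ≤ z) :
    ∫ y, min z (max y 0) ∂ν = (1 - exp (-θ * z)) / θ := by
  have hnonneg : ∀ y : ℝ, 0 ≤ min z (max y 0) := fun y => le_min hz (le_max_right _ _)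
  have hint : Integrable (fun y : ℝ => min z (max y 0)) ν := by
    refine Integrable.of_bound (C := z) (by fun_prop) (ae_of_all _ fun y => ?_)
    rw [norm_of_nonneg (hnonneg y)]
    exact min_le_left _ _
  rw [hint.integral_eq_integral_meas_lt (ae_of_all _ hnonneg)]
  have htail : ∀ t ∈ Set.Ioi (0 : ℝ), ν.real {y | t < min z (max y 0)} =
      (Set.Iio z).indicator (fun t => exp (-θ * t)) t := by
    intro t ht
    rw [Set.mem_Ioi] at ht
    by_cases htz : t < z
    · have hset : {y : ℝ | t < min z (max y 0)} = Set.Ioi t := by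
        ext y
        simp [htz, not_lt.2 ht.le]
      rw [hset, Set.indicator_of_mem (Set.mem_Iio.2 htz), measureReal_def, hν t ht,
        ENNReal.toReal_ofReal (exp_pos _).le]
    · simp [htz]
  rw [setIntegral_congr_fun measurableSet_Ioi htail, setIntegral_indicator measurableSet_Iio,
    Set.Ioi_inter_Iio, ← integral_Ioc_eq_integral_Ioo, ← intervalIntegral.integral_of_le hz,
    intervalIntegral.integral_comp_mul_left (fun t => exp t) (neg_ne_zero.2 hθ.ne'), integral_exp]
  simp only [mul_zero, exp_zero, smul_eq_mul]
  field_simp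
  ring

/-- **Lemma 1.2.** If `Y` is exponential with rate `θ > 0` and `Z ≥ 0` has finite mean and
is independent of `Y`, then `E[min{Z,Y}] ≤ 2 E[Z] / (2 + θ E[Z])`. -/
theorem no_directed_fractal_percolation_stmt0
    {Ω : Type*} [MeasurableSpace Ω] (μ : Measure Ω) [IsProbabilityMeasure μ]
    (θ : ℝ) (hθ : 0 < θ) (Y Z : Ω → ℝ)
    (hYmeas : Measurable Y) (hZmeas : Measurable Z)
    (hYexp : ∀ y : ℝ, 0 < y → μ {ω | Y ω > y} = ENNReal.ofReal (Real.exp (-θ * y)))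
    (hZnonneg : ∀ ω, 0 ≤ Z ω) (hZint : Integrable Z μ)
    (hindep : IndepFun Z Y μ) :
    ∫ ω, min (Z ω) (Y ω) ∂μ ≤ 2 * (∫ ω, Z ω ∂μ) / (2 + θ * ∫ ω, Z ω ∂μ) := by
  set m := ∫ ω, Z ω ∂μ with hm
  have hm0 : 0 ≤ m := integral_nonneg hZnonneg
  by_cases hminint : Integrable (fun ω => min (Z ω) (Y ω)) μ
  swap
  · rw [integral_undef hminint]
    positivity
  have : IsProbabilityMeasure (μ.map Y) := Measure.isProbabilityMeasure_map hYmeas.aemeasurable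
  have : IsProbabilityMeasure (μ.map Z) := Measure.isProbabilityMeasure_map hZmeas.aemeasurable
  have hν : ∀ y : ℝ, 0 < y → μ.map Y (Set.Ioi y) = ENNReal.ofReal (exp (-θ * y)) := by
    intro y hy
    rw [Measure.map_apply hYmeas measurableSet_Ioi]
    exact hYexp y hy
  have hint : Integrable (fun ω => min (Z ω) (max (Y ω) 0)) μ := by
    refine hZint.mono' (by fun_prop) (ae_of_all _ fun ω => ?_)
    rw [norm_of_nonneg (le_min (hZnonneg ω) (le_max_right _ _))]
    exact min_le_left _ _
  have hlaw := (indepFun_iff_map_prod_eq_prod_map_map hZmeas.aemeasurable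
    hYmeas.aemeasurable).1 hindep
  have hpair : AEMeasurable (fun ω => (Z ω, Y ω)) μ := by fun_prop
  have hmeas : Measurable fun p : ℝ × ℝ => min p.1 (max p.2 0) := by fun_prop
  have hprodint : Integrable (fun p : ℝ × ℝ => min p.1 (max p.2 0))
      ((μ.map Z).prod (μ.map Y)) := by
    rw [← hlaw, integrable_map_measure hmeas.aestronglyMeasurable hpair]
    exact hint
  have hinner := hprodint.integral_prod_left.comp_measurable hZmeas
  have hmean : ∫ ω, min (Z ω) (max (Y ω) 0) ∂μ
      = ∫ ω, ∫ y, min (Z ω) (max y 0) ∂(μ.map Y) ∂μ := by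
    rw [← integral_map (f := fun p : ℝ × ℝ => min p.1 (max p.2 0)) hpair
      hmeas.aestronglyMeasurable, hlaw, integral_prod _ hprodint,
      integral_map hZmeas.aemeasurable hprodint.integral_prod_left.aestronglyMeasurable]
  have htangent : ∀ ω, ∫ y, min (Z ω) (max y 0) ∂(μ.map Y)
      ≤ (1 - exp (-(θ * m))) / θ + exp (-(θ * m)) * (Z ω - m) := by
    intro ω
    rw [integral_min_max_zero_of_exp_tail hθ hν (hZnonneg ω)]
    have hexp : exp (-θ * Z ω) = exp (-(θ * m)) * exp (θ * (m - Z ω)) := by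
      rw [← exp_add]
      ring_nf
    have hmul := mul_le_mul_of_nonneg_left (add_one_le_exp (θ * (m - Z ω)))
      (exp_pos (-(θ * m))).le
    rw [hexp, div_add' _ _ _ hθ.ne']
    gcongr
    linarith
  have hZm : Integrable (fun ω => Z ω - m) μ := hZint.sub (integrable_const m)
  calc ∫ ω, min (Z ω) (Y ω) ∂μ ≤ ∫ ω, min (Z ω) (max (Y ω) 0) ∂μ :=
        integral_mono hminint hint fun ω => min_le_min_left _ (le_max_left _ _)
    _ = ∫ ω, ∫ y, min (Z ω) (max y 0) ∂(μ.map Y) ∂μ := hmean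
    _ ≤ ∫ ω, ((1 - exp (-(θ * m))) / θ + exp (-(θ * m)) * (Z ω - m)) ∂μ :=
        integral_mono hinner ((integrable_const _).add (hZm.const_mul _)) htangent
    _ = (1 - exp (-(θ * m))) / θ := by
        rw [integral_add (integrable_const _) (hZm.const_mul _), integral_const_mul,
          integral_sub hZint (integrable_const m), ← hm]
        simp
    _ ≤ 2 * (θ * m) / (2 + θ * m) / θ := by
        gcongr
        exact one_sub_exp_neg_le_two_mul_div (by positivity)
    _ = 2 * m / (2 + θ * m) := by
        field_simp
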